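/- arXiv:2101.04302 — 7 statements merged into one kernel-verified Lean document; each statement's English description precedes it below -/
import Mathlib

section
/- Let η : [0,∞) → ℝ² be a twice continuously differentiable solution of the expander ODE η''(s)/‖η'(s)‖² + s·η'(s) − η(s) = 0 with η'(s) ≠ 0 for every s ≥ 0. Then there exist a vector a ∈ ℝ² and constants C₁, C₂ > 0 such that ‖η(s) − s·a‖ ≤ C₁·exp(−C₂·s²) for all s ≥ 0. -/
open Set

open Filter Topology

lemma antitoneOn_Ici_of_hasDerivWithinAt_nonpos {f f' : ℝ → ℝ} {a : ℝ}
    (hf : ∀ x ∈ Ici a, HasDerivWithinAt f (f' x) (Ici a) x)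
    (hf' : ∀ x ∈ Ici a, f' x ≤ 0) : AntitoneOn f (Ici a) := by
  refine antitoneOn_of_hasDerivWithinAt_nonpos (f' := f') (convex_Ici a)
    (fun x hx => (hf x hx).continuousWithinAt) (fun x hx => ?_) (fun x hx => ?_)
  · exact (hf x (interior_subset hx)).mono interior_subset
  · exact hf' x (interior_subset hx)

/-- A linear differential inequality `p' ≤ -g' p` gives `p ≤ p(a) exp(g(a) - g)`. -/
lemma le_mul_exp_of_deriv_le_neg_mul {p p' g g' : ℝ → ℝ} {a : ℝ}
    (hp : ∀ x ∈ Ici a, HasDerivWithinAt p (p' x) (Ici a) x)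
    (hg : ∀ x ∈ Ici a, HasDerivWithinAt g (g' x) (Ici a) x)
    (h : ∀ x ∈ Ici a, p' x ≤ -(g' x * p x)) {s : ℝ} (hs : s ∈ Ici a) :
    p s ≤ p a * Real.exp (g a - g s) := by
  have hanti : AntitoneOn (fun x => p x * Real.exp (g x)) (Ici a) := by
    refine antitoneOn_Ici_of_hasDerivWithinAt_nonpos
      (fun x hx => (hp x hx).mul (hg x hx).exp) (fun x hx => ?_)
    nlinarith [mul_le_mul_of_nonneg_right (h x hx) (Real.exp_pos (g x)).le]
  have hle : p s * Real.exp (g s) ≤ p a * Real.exp (g a) := hanti self_mem_Ici hs hs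
  rw [Real.exp_sub, ← mul_div_assoc]
  exact (le_div_iff₀ (Real.exp_pos _)).2 hle

lemma le_add_of_deriv_le {h h' b b' : ℝ → ℝ} {a : ℝ}
    (hh : ∀ x ∈ Ici a, HasDerivWithinAt h (h' x) (Ici a) x)
    (hb : ∀ x ∈ Ici a, HasDerivWithinAt b (b' x) (Ici a) x)
    (hle : ∀ x ∈ Ici a, h' x ≤ b' x) {s : ℝ} (hs : s ∈ Ici a) :
    h s ≤ h a + (b s - b a) := by
  have hanti := antitoneOn_Ici_of_hasDerivWithinAt_nonpos
    (fun x hx => (hh x hx).sub (hb x hx)) (fun x hx => sub_nonpos.2 (hle x hx))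
  have := hanti self_mem_Ici hs hs
  simp only [Pi.sub_apply] at this
  linarith

/-- If `h' ≤ √p` and `p' = -2 s p / h²`, then `h` stays bounded. -/
lemma eventually_bounded_of_deriv_le_sqrt {h h' p : ℝ → ℝ}
    (hpos : ∀ s ∈ Ici (0:ℝ), 0 < h s) (hp0 : ∀ s ∈ Ici (0:ℝ), 0 ≤ p s)
    (hh : ∀ s ∈ Ici (0:ℝ), HasDerivWithinAt h (h' s) (Ici 0) s)
    (hle : ∀ s ∈ Ici (0:ℝ), h' s ≤ √(p s))
    (hp : ∀ s ∈ Ici (0:ℝ), HasDerivWithinAt p (-(2 * s / h s ^ 2 * p s)) (Ici 0) s) :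
    ∃ M T : ℝ, 0 < M ∧ 1 ≤ T ∧ ∀ s ∈ Ici T, h s ≤ M := by
  have hh_from : ∀ a : ℝ, 0 ≤ a → ∀ s ∈ Ici a, HasDerivWithinAt h (h' s) (Ici a) s :=
    fun a ha s hs => (hh s (ha.trans hs)).mono (Ici_subset_Ici.2 ha)
  have hp_from : ∀ a : ℝ, 0 ≤ a → ∀ s ∈ Ici a,
      HasDerivWithinAt p (-(2 * s / h s ^ 2 * p s)) (Ici a) s :=
    fun a ha s hs => (hp s (ha.trans hs)).mono (Ici_subset_Ici.2 ha)
  have hlog : ∀ k a : ℝ, 1 ≤ a → ∀ s ∈ Ici a,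
      HasDerivWithinAt (fun x => k * Real.log x) (k * s⁻¹) (Ici a) s := fun k a ha s hs =>
    ((Real.hasDerivAt_log (by have := ha.trans hs; positivity)).const_mul k).hasDerivWithinAt
  have hlin : ∀ k a : ℝ, ∀ s ∈ Ici a, HasDerivWithinAt (fun x => k * x) k (Ici a) s :=
    fun k a s _ => by simpa using (hasDerivAt_id s).hasDerivWithinAt.const_mul k
  -- A linear bound on `h` forces `p` to decay like a power.
  have hpow : ∀ m a : ℝ, 0 < m → 1 ≤ a → (∀ s ∈ Ici a, h s ≤ m * s) → ∀ s ∈ Ici a,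
      p s ≤ p a * Real.exp (2 / m ^ 2 * Real.log a - 2 / m ^ 2 * Real.log s) := by
    intro m a hm ha hms s hs
    refine le_mul_exp_of_deriv_le_neg_mul (hp_from a (by linarith)) (hlog (2 / m ^ 2) a ha)
      (fun x hx => ?_) hs
    have hx1 : 1 ≤ x := ha.trans hx
    have hx0 : (0:ℝ) < x := by linarith
    have hhx := hpos x hx0.le
    refine neg_le_neg (mul_le_mul_of_nonneg_right ?_ (hp0 x hx0.le))
    calc 2 / m ^ 2 * x⁻¹ = 2 * x / (m * x) ^ 2 := by field_simp
      _ ≤ 2 * x / h x ^ 2 := by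
        have := hms x hx
        gcongr
  have hpanti : AntitoneOn p (Ici 0) := by
    refine antitoneOn_Ici_of_hasDerivWithinAt_nonpos hp (fun x hx => neg_nonpos.2 ?_)
    have := hp0 x hx
    have : (0:ℝ) ≤ x := hx
    positivity
  have hh0 := hpos 0 self_mem_Ici
  have hgrow : ∀ s ∈ Ici (1:ℝ), h s ≤ (h 0 + √(p 0)) * s := by
    intro s hs
    have hs1 : (1:ℝ) ≤ s := hs
    have hs0 : s ∈ Ici (0:ℝ) := by simp only [mem_Ici]; linarith
    have := le_add_of_deriv_le hh (hlin (√(p 0)) 0)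
      (fun x hx => (hle x hx).trans (Real.sqrt_le_sqrt (hpanti self_mem_Ici hx hx))) hs0
    nlinarith
  have hm : 0 < h 0 + √(p 0) := by positivity
  have hlim : Tendsto (fun s => p 1 * Real.exp (2 / (h 0 + √(p 0)) ^ 2 * Real.log 1 -
      2 / (h 0 + √(p 0)) ^ 2 * Real.log s)) atTop (𝓝 0) := by
    have h1 : Tendsto (fun s => 2 / (h 0 + √(p 0)) ^ 2 * Real.log s) atTop atTop :=
      Real.tendsto_log_atTop.const_mul_atTop (by positivity)
    simpa using (Real.tendsto_exp_neg_atTop_nhds_zero.comp h1).const_mul (p 1)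
  obtain ⟨S, hS1, hS⟩ : ∃ S : ℝ, 1 ≤ S ∧ ∀ s ∈ Ici S, p s ≤ (1 / 4) ^ 2 := by
    obtain ⟨S, hS⟩ := eventually_atTop.1 (hlim.eventually_le_const
      (show (0:ℝ) < (1 / 4) ^ 2 by norm_num))
    refine ⟨max S 1, le_max_right _ _, fun s hs => ?_⟩
    have hs' : max S 1 ≤ s := hs
    exact (hpow _ 1 hm le_rfl hgrow s ((le_max_right S 1).trans hs')).trans
      (hS s ((le_max_left S 1).trans hs'))
  set T := max S (4 * h S)
  have hST : S ≤ T := le_max_left _ _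
  have hT1 : 1 ≤ T := hS1.trans hST
  have hhalf : ∀ s ∈ Ici T, h s ≤ 1 / 2 * s := by
    intro s hs
    have := le_add_of_deriv_le (hh_from S (by linarith)) (hlin (1 / 4) S)
      (fun x hx => (hle x ((zero_le_one.trans hS1).trans hx)).trans
        (Real.sqrt_le_iff.2 ⟨by norm_num, hS x hx⟩)) (hST.trans hs)
    have h4 : 4 * h S ≤ s := (le_max_right _ _).trans hs
    linarith
  have hsqrt : ∀ s ∈ Ici T, √(p s) ≤ √(p T) * T ^ 4 / s ^ 2 := by
    intro s hs
    have hs1 : 1 ≤ s := hT1.trans hs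
    have hpT := hp0 T (by simp only [mem_Ici]; linarith)
    refine Real.sqrt_le_iff.2 ⟨by positivity,
      (hpow (1 / 2) T (by norm_num) hT1 hhalf s hs).trans ?_⟩
    rw [show (2:ℝ) / (1 / 2) ^ 2 = (8 : ℕ) by norm_num, Real.exp_sub, ← Real.log_pow,
      ← Real.log_pow, Real.exp_log (by positivity), Real.exp_log (by positivity),
      div_pow, mul_pow, Real.sq_sqrt hpT, ← mul_div_assoc, ← pow_mul, ← pow_mul]
    gcongr
    norm_num
  refine ⟨h T + √(p T) * T ^ 4 / T, T, ?_, hT1, fun s hs => ?_⟩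
  · have := hpos T (by simp only [mem_Ici]; linarith)
    positivity
  · have hb : ∀ x ∈ Ici T, HasDerivWithinAt (fun x => -(√(p T) * T ^ 4) * x⁻¹)
        (√(p T) * T ^ 4 / x ^ 2) (Ici T) x := by
      intro x hx
      have hx1 : 1 ≤ x := hT1.trans hx
      exact (((hasDerivAt_inv (by positivity : x ≠ 0)).const_mul
        (-(√(p T) * T ^ 4))).congr_deriv (by ring)).hasDerivWithinAt
    have := le_add_of_deriv_le (hh_from T (by linarith)) hb
      (fun x hx => (hle x ((zero_le_one.trans hT1).trans hx)).trans (hsqrt x hx)) hs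
    have hs1 : 1 ≤ s := hT1.trans hs
    have hnn : 0 ≤ √(p T) * T ^ 4 * s⁻¹ := by positivity
    rw [div_eq_mul_inv]
    linarith

lemma exists_forall_norm_sub_le {E : Type*} [NormedAddCommGroup E] [CompleteSpace E]
    {F : ℝ → E} {B : ℝ → ℝ} {T : ℝ} (hB : Tendsto B atTop (𝓝 0))
    (h : ∀ s ∈ Ici T, ∀ t ∈ Ici s, ‖F t - F s‖ ≤ B s) :
    ∃ a : E, ∀ s ∈ Ici T, ‖F s - a‖ ≤ B s := by
  have hc : CauchySeq F := by
    refine Metric.cauchySeq_iff'.2 fun ε hε => ?_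
    obtain ⟨N, hN, hTN⟩ := ((hB.eventually_lt_const hε).and (eventually_ge_atTop T)).exists
    exact ⟨N, fun n hn => by rw [dist_eq_norm]; exact (h N hTN n hn).trans_lt hN⟩
  obtain ⟨a, ha⟩ := cauchySeq_tendsto_of_complete hc
  refine ⟨a, fun s hs => ?_⟩
  rw [norm_sub_rev]
  exact le_of_tendsto (ha.sub_const (F s)).norm
    ((eventually_ge_atTop s).mono fun t ht => h s hs t ht)

/-- If `η - s η'` has Gaussian decay, then `η` is asymptotic to a line through the origin. -/
lemma exists_norm_sub_smul_le_of_support_decay {E : Type*} [NormedAddCommGroup E]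
    [NormedSpace ℝ E] [CompleteSpace E] {η η' : ℝ → E} {T D c : ℝ} (hT : 1 ≤ T)
    (hD : 0 ≤ D) (hc : 0 < c)
    (hη : ∀ s ∈ Ici T, HasDerivWithinAt η (η' s) (Ici T) s)
    (hdecay : ∀ s ∈ Ici T, ‖η s - s • η' s‖ ≤ D * Real.exp (-c * s ^ 2)) :
    ∃ a : E, ∀ s ∈ Ici T, ‖η s - s • a‖ ≤ D / (2 * c) * Real.exp (-c * s ^ 2) := by
  set B : ℝ → ℝ := fun s => D / (2 * c) * (Real.exp (-c * s ^ 2) * s⁻¹) with hBdef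
  have hB0 : Tendsto B atTop (𝓝 0) := by
    have h1 : Tendsto (fun s : ℝ => c * s ^ 2) atTop atTop :=
      (tendsto_pow_atTop two_ne_zero).const_mul_atTop hc
    simpa [hBdef] using ((Real.tendsto_exp_neg_atTop_nhds_zero.comp h1).mul
      tendsto_inv_atTop_zero).const_mul (D / (2 * c))
  have hBpos : ∀ s ∈ Ici T, 0 ≤ B s := fun s hs => by
    have : 1 ≤ s := hT.trans hs
    positivity
  have hB' : ∀ s ∈ Ici T, HasDerivAt (fun x => -B x)
      (D * Real.exp (-c * s ^ 2) * (1 + 1 / (2 * c * s ^ 2))) s := by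
    intro s hs
    have hs1 : 1 ≤ s := hT.trans hs
    have hs0 : s ≠ 0 := by positivity
    refine (((((hasDerivAt_pow 2 s).const_mul (-c)).exp).mul
      (hasDerivAt_inv hs0)).const_mul (D / (2 * c))).neg.congr_deriv ?_
    push_cast
    field_simp
    ring
  have hF' : ∀ s ∈ Ici T, HasDerivWithinAt (fun x => x⁻¹ • η x)
      (-((s ^ 2)⁻¹ • (η s - s • η' s))) (Ici T) s := by
    intro s hs
    have hs1 : 1 ≤ s := hT.trans hs
    have hs0 : s ≠ 0 := by positivity
    refine ((hasDerivAt_inv hs0).hasDerivWithinAt.smul (hη s hs)).congr_deriv ?_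
    rw [smul_sub, smul_smul, show (s ^ 2)⁻¹ * s = s⁻¹ by field_simp, neg_smul]
    abel
  have hF'le : ∀ s ∈ Ici T, ‖-((s ^ 2)⁻¹ • (η s - s • η' s))‖ ≤
      D * Real.exp (-c * s ^ 2) * (1 + 1 / (2 * c * s ^ 2)) := by
    intro s hs
    have hs1 : 1 ≤ s := hT.trans hs
    rw [norm_neg, norm_smul, Real.norm_of_nonneg (by positivity)]
    calc (s ^ 2)⁻¹ * ‖η s - s • η' s‖ ≤ 1 * (D * Real.exp (-c * s ^ 2)) := by
          gcongr
          · exact inv_le_one_of_one_le₀ (one_le_pow₀ hs1)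
          · exact hdecay s hs
      _ ≤ D * Real.exp (-c * s ^ 2) * (1 + 1 / (2 * c * s ^ 2)) := by
          rw [one_mul]
          refine le_mul_of_one_le_right (by positivity) ?_
          have : 0 ≤ 1 / (2 * c * s ^ 2) := by positivity
          linarith
  obtain ⟨a, ha⟩ := exists_forall_norm_sub_le (F := fun x => x⁻¹ • η x) (T := T) hB0
    (fun s hs t ht => by
      have hsub : ∀ x ∈ Icc s t, x ∈ Ici T := fun x hx => le_trans hs hx.1
      have := image_norm_le_of_norm_deriv_right_le_deriv_boundary'
        (f := fun x => x⁻¹ • η x - s⁻¹ • η s) (B := fun x => B s + -B x) (a := s) (b := t)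
        (fun x hx => (((hF' x (hsub x hx)).continuousWithinAt.mono hsub).sub_const _))
        (fun x hx => ((hF' x (hsub x (Ico_subset_Icc_self hx))).mono
          (Ici_subset_Ici.2 (hsub x (Ico_subset_Icc_self hx)))).sub_const _)
        (by simp)
        (fun x hx => ((hB' x (hsub x hx)).continuousAt.continuousWithinAt).const_add _)
        (fun x hx => ((hB' x (hsub x (Ico_subset_Icc_self hx))).hasDerivWithinAt).const_add _)
        (fun x hx => hF'le x (hsub x (Ico_subset_Icc_self hx))) (right_mem_Icc.2 ht)
      have hBt := hBpos t (mem_Ici.2 (le_trans (mem_Ici.1 hs) (mem_Ici.1 ht)))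
      linarith)
  refine ⟨a, fun s hs => ?_⟩
  have hs1 : 1 ≤ s := hT.trans hs
  have hs0 : 0 < s := by linarith
  calc ‖η s - s • a‖ = s * ‖s⁻¹ • η s - a‖ := by
        rw [← Real.norm_of_nonneg hs0.le, ← norm_smul, Real.norm_of_nonneg hs0.le, smul_sub,
          smul_inv_smul₀ hs0.ne']
    _ ≤ s * B s := by gcongr; exact ha s hs
    _ = D / (2 * c) * Real.exp (-c * s ^ 2) := by simp only [hBdef]; field_simp

/-- Expander asymptotics in an arbitrary real Hilbert space. -/
lemma exists_asymptotic_line_of_expander {E : Type*} [NormedAddCommGroup E]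
    [InnerProductSpace ℝ E] [CompleteSpace E] (η η' η'' : ℝ → E)
    (hderiv1 : ∀ s ∈ Ici (0:ℝ), HasDerivWithinAt η (η' s) (Ici 0) s)
    (hderiv2 : ∀ s ∈ Ici (0:ℝ), HasDerivWithinAt η' (η'' s) (Ici 0) s)
    (hreg : ∀ s ∈ Ici (0:ℝ), η' s ≠ 0)
    (hode : ∀ s ∈ Ici (0:ℝ),
      (‖η' s‖ ^ 2)⁻¹ • η'' s + s • η' s - η s = 0) :
    ∃ (a : E) (C₁ C₂ : ℝ), 0 < C₁ ∧ 0 < C₂ ∧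
      ∀ s ∈ Ici (0:ℝ), ‖η s - s • a‖ ≤ C₁ * Real.exp (-C₂ * s ^ 2) := by
  set w : ℝ → E := fun s => η s - s • η' s
  have hη'' : ∀ s ∈ Ici (0:ℝ), η'' s = ‖η' s‖ ^ 2 • w s := by
    intro s hs
    have hn : ‖η' s‖ ^ 2 ≠ 0 := pow_ne_zero 2 (norm_ne_zero_iff.2 (hreg s hs))
    have h1 : (‖η' s‖ ^ 2)⁻¹ • η'' s = w s := eq_sub_of_add_eq (sub_eq_zero.1 (hode s hs))
    rw [← h1, smul_inv_smul₀ hn]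
  have hw' : ∀ s ∈ Ici (0:ℝ), HasDerivWithinAt w (-(s * ‖η' s‖ ^ 2) • w s) (Ici 0) s := by
    intro s hs
    refine ((hderiv1 s hs).sub
      ((hasDerivAt_id s).hasDerivWithinAt.smul (hderiv2 s hs))).congr_deriv ?_
    simp [hη'' s hs, smul_smul]
  have hp : ∀ s ∈ Ici (0:ℝ), HasDerivWithinAt (fun x => ‖w x‖ ^ 2)
      (-(2 * s / ‖η' s‖⁻¹ ^ 2 * ‖w s‖ ^ 2)) (Ici 0) s := by
    intro s hs
    refine (hw' s hs).norm_sq.congr_deriv ?_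
    rw [inner_smul_right, real_inner_self_eq_norm_sq]
    field_simp
  have hh : ∀ s ∈ Ici (0:ℝ), HasDerivWithinAt (fun x => ‖η' x‖⁻¹)
      (-(inner ℝ (η' s) (w s) / ‖η' s‖)) (Ici 0) s := by
    intro s hs
    have hn : ‖η' s‖ ≠ 0 := norm_ne_zero_iff.2 (hreg s hs)
    have h1 := ((hderiv2 s hs).norm_sq.sqrt (pow_ne_zero 2 hn)).inv (by simpa using hn)
    simp only [Real.sqrt_sq (norm_nonneg _), hη'' s hs, inner_smul_right] at h1
    refine h1.congr_deriv ?_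
    field_simp
  have hle : ∀ s ∈ Ici (0:ℝ), -(inner ℝ (η' s) (w s) / ‖η' s‖) ≤ √(‖w s‖ ^ 2) := by
    intro s hs
    have hn : 0 < ‖η' s‖ := norm_pos_iff.2 (hreg s hs)
    rw [Real.sqrt_sq (norm_nonneg _), ← neg_div, div_le_iff₀ hn, mul_comm]
    exact (neg_le_abs _).trans (abs_real_inner_le_norm _ _)
  obtain ⟨M, T, hM, hT, hbound⟩ := eventually_bounded_of_deriv_le_sqrt
    (fun s hs => inv_pos.2 (norm_pos_iff.2 (hreg s hs))) (fun s _ => sq_nonneg ‖w s‖) hh hle hp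
  have hT0 : (0:ℝ) ≤ T := by linarith
  have hsub : Ici T ⊆ Ici (0:ℝ) := Ici_subset_Ici.2 hT0
  set c : ℝ := 1 / (2 * M ^ 2) with hc
  have hcpos : 0 < c := by positivity
  set D : ℝ := ‖w T‖ * Real.exp (c * T ^ 2) with hDdef
  have hdecay : ∀ s ∈ Ici T, ‖η s - s • η' s‖ ≤ D * Real.exp (-c * s ^ 2) := by
    intro s hs
    have h1 := le_mul_exp_of_deriv_le_neg_mul (g := fun x => 2 * c * x ^ 2)
      (g' := fun x => 2 * x / M ^ 2) (fun x hx => (hp x (hsub hx)).mono hsub)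
      (fun x _ => by
        refine ((hasDerivAt_pow 2 x).const_mul (2 * c)).hasDerivWithinAt.congr_deriv ?_
        simp only [hc]
        field_simp
        norm_num)
      (fun x hx => by
        have hx0 : (0:ℝ) ≤ x := hsub hx
        have hn : 0 < ‖η' x‖⁻¹ := inv_pos.2 (norm_pos_iff.2 (hreg x hx0))
        have := hbound x hx
        refine neg_le_neg (mul_le_mul_of_nonneg_right ?_ (sq_nonneg _))
        gcongr) hs
    refine le_of_sq_le_sq (h1.trans (le_of_eq ?_)) (by positivity)
    rw [hDdef, mul_assoc ‖w T‖, ← Real.exp_add, mul_pow, ← Real.exp_nat_mul]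
    congr 2
    push_cast
    ring
  obtain ⟨a, ha⟩ := exists_norm_sub_smul_le_of_support_decay hT (by positivity) hcpos
    (fun s hs => (hderiv1 s (hsub hs)).mono hsub) hdecay
  have hcontη : ContinuousOn (fun s => η s - s • a) (Icc 0 T) := fun s hs =>
    ((hderiv1 s hs.1).continuousWithinAt.mono Icc_subset_Ici_self).sub
      (continuousWithinAt_id.smul continuousWithinAt_const)
  obtain ⟨K, hK⟩ := isCompact_Icc.exists_bound_of_continuousOn hcontη
  have hK0 : 0 ≤ K := (norm_nonneg _).trans (hK 0 ⟨le_rfl, hT0⟩)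
  have hD : 0 ≤ D / (2 * c) := by positivity
  refine ⟨a, D / (2 * c) + K * Real.exp (c * T ^ 2) + 1, c, by positivity, hcpos, fun s hs => ?_⟩
  have hs0 : (0:ℝ) ≤ s := hs
  rcases le_total T s with h | h
  · refine (ha s h).trans (mul_le_mul_of_nonneg_right ?_ (Real.exp_pos _).le)
    have : 0 ≤ K * Real.exp (c * T ^ 2) := by positivity
    linarith
  · calc ‖η s - s • a‖ ≤ K * 1 := by rw [mul_one]; exact hK s ⟨hs, h⟩
      _ ≤ K * Real.exp (c * T ^ 2 + -c * s ^ 2) := by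
        gcongr
        refine Real.one_le_exp ?_
        have : c * s ^ 2 ≤ c * T ^ 2 := by gcongr
        linarith
      _ = K * Real.exp (c * T ^ 2) * Real.exp (-c * s ^ 2) := by rw [Real.exp_add, mul_assoc]
      _ ≤ _ := by
        gcongr
        linarith

/-- Asymptotics of expanding solitons: a solution of the expander ODE
`η''/‖η'‖² + s·η' − η = 0` on `[0,∞)` with nonvanishing derivative satisfies
`η(s) = s·a + O(exp(−C s²))`. -/
theorem expander_asymptotics
    (η η' η'' : ℝ → EuclideanSpace ℝ (Fin 2))
    (hderiv1 : ∀ s ∈ Ici (0:ℝ), HasDerivWithinAt η (η' s) (Ici 0) s)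
    (hderiv2 : ∀ s ∈ Ici (0:ℝ), HasDerivWithinAt η' (η'' s) (Ici 0) s)
    (hcont : ContinuousOn η'' (Ici 0))
    (hreg : ∀ s ∈ Ici (0:ℝ), η' s ≠ 0)
    (hode : ∀ s ∈ Ici (0:ℝ),
      (‖η' s‖ ^ 2)⁻¹ • η'' s + s • η' s - η s = 0) :
    ∃ (a : EuclideanSpace ℝ (Fin 2)) (C₁ C₂ : ℝ), 0 < C₁ ∧ 0 < C₂ ∧
      ∀ s ∈ Ici (0:ℝ), ‖η s - s • a‖ ≤ C₁ * Real.exp (-C₂ * s ^ 2) := by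
  exact exists_asymptotic_line_of_expander η η' η'' hderiv1 hderiv2 hreg hode
end

section
/- Let η : [0,∞) → ℝ² be a twice continuously differentiable solution of the expander ODE η''(s)/‖η'(s)‖² + s·η'(s) − η(s) = 0 with η'(s) ≠ 0 for every s ≥ 0. Define μ(s) = s·η'(s) − η(s) and σ(s) = ‖μ(s)‖². Then μ'(s) = −s·‖η'(s)‖²·μ(s) and σ'(s) = −2s·‖η'(s)‖²·σ(s) for all s ≥ 0; in particular, σ is monotone nonincreasing on [0,∞), so σ(s) ≤ σ(0) for all s ≥ 0. -/
open Set

/-- For a solution `η` of the expander ODE, the quantities `μ(s) = s·η'(s) − η(s)` and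
`σ(s) = ‖μ(s)‖²` satisfy `μ' = −s‖η'‖²·μ` and `σ' = −2s‖η'‖²·σ`; in particular `σ` is
monotone nonincreasing on `[0,∞)`, so `σ(s) ≤ σ(0)`. -/
theorem expander_mu_sigma_evolution
    (η η' η'' : ℝ → EuclideanSpace ℝ (Fin 2))
    (hderiv1 : ∀ s ∈ Ici (0:ℝ), HasDerivWithinAt η (η' s) (Ici 0) s)
    (hderiv2 : ∀ s ∈ Ici (0:ℝ), HasDerivWithinAt η' (η'' s) (Ici 0) s)
    (hcont : ContinuousOn η'' (Ici 0))
    (hreg : ∀ s ∈ Ici (0:ℝ), η' s ≠ 0)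
    (hode : ∀ s ∈ Ici (0:ℝ),
      (‖η' s‖ ^ 2)⁻¹ • η'' s + s • η' s - η s = 0) :
    (∀ s ∈ Ici (0:ℝ),
      HasDerivWithinAt (fun r => r • η' r - η r)
        ((-(s * ‖η' s‖ ^ 2)) • (s • η' s - η s)) (Ici 0) s) ∧
    (∀ s ∈ Ici (0:ℝ),
      HasDerivWithinAt (fun r => ‖r • η' r - η r‖ ^ 2)
        ((-(2 * s * ‖η' s‖ ^ 2)) * ‖s • η' s - η s‖ ^ 2) (Ici 0) s) ∧
    AntitoneOn (fun r => ‖r • η' r - η r‖ ^ 2) (Ici 0) ∧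
    (∀ s ∈ Ici (0:ℝ), ‖s • η' s - η s‖ ^ 2 ≤ ‖(0:ℝ) • η' 0 - η 0‖ ^ 2) := by
  have hmu : ∀ s ∈ Ici (0:ℝ), HasDerivWithinAt (fun r => r • η' r - η r)
      ((-(s * ‖η' s‖ ^ 2)) • (s • η' s - η s)) (Ici 0) s := by
    intro s hs
    have hne : ‖η' s‖ ^ 2 ≠ 0 := pow_ne_zero 2 (norm_ne_zero_iff.mpr (hreg s hs))
    have hη'' : η'' s = -(‖η' s‖ ^ 2 • (s • η' s - η s)) := by
      have h := hode s hs
      rw [add_sub_assoc, add_eq_zero_iff_eq_neg] at h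
      rw [← smul_neg, ← h, smul_inv_smul₀ hne]
    refine (((hasDerivWithinAt_id s _).smul (hderiv2 s hs)).sub (hderiv1 s hs)).congr_deriv ?_
    simp only [id, one_smul, add_sub_cancel_right]
    rw [hη'', smul_neg, smul_smul, neg_smul]
  have hsigma : ∀ s ∈ Ici (0:ℝ), HasDerivWithinAt (fun r => ‖r • η' r - η r‖ ^ 2)
      ((-(2 * s * ‖η' s‖ ^ 2)) * ‖s • η' s - η s‖ ^ 2) (Ici 0) s := by
    intro s hs
    refine (hmu s hs).norm_sq.congr_deriv ?_
    rw [real_inner_smul_right, real_inner_self_eq_norm_sq]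
    ring
  have hanti : AntitoneOn (fun r => ‖r • η' r - η r‖ ^ 2) (Ici 0) := by
    refine antitoneOn_of_hasDerivWithinAt_nonpos (convex_Ici 0)
      (fun s hs => (hsigma s hs).continuousWithinAt)
      (fun s hs => (hsigma s (interior_subset hs)).mono interior_subset) ?_
    intro s hs
    have hs0 : 0 ≤ s := interior_subset hs
    rw [neg_mul, neg_nonpos]
    positivity
  exact ⟨hmu, hsigma, hanti, fun s hs => hanti self_mem_Ici hs hs⟩
end

section
/- Let η : ℝ → ℝ² be twice continuously differentiable with η'(s) ≠ 0 for all s ∈ ℝ, and define γ(t,x) = √(2t)·η(x/√(2t)) for t > 0 and x ∈ ℝ. Then γ satisfies the parametrized curve-shortening flow equation ∂_t γ(t,x) = ∂²_x γ(t,x)/‖∂_x γ(t,x)‖² for all t > 0 and x ∈ ℝ if and only if η satisfies the expander ODE η''(s)/‖η'(s)‖² + s·η'(s) − η(s) = 0 for all s ∈ ℝ. -/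
open Set

theorem deriv_smul_comp_div {E : Type*} [NormedAddCommGroup E] [NormedSpace ℝ E]
    (f : ℝ → E) {r : ℝ} (hr : r ≠ 0) :
    deriv (fun x : ℝ => r • f (x / r)) = fun x => deriv f (x / r) := by
  funext x
  simp only [div_eq_inv_mul]
  rw [deriv_fun_const_smul_field, deriv_comp_mul_left, smul_inv_smul₀ hr]

theorem deriv_comp_div_const {E : Type*} [NormedAddCommGroup E] [NormedSpace ℝ E]
    (f : ℝ → E) (r x : ℝ) :
    deriv (fun x : ℝ => f (x / r)) x = r⁻¹ • deriv f (x / r) := by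
  simp only [div_eq_inv_mul]
  rw [deriv_comp_mul_left]

theorem hasDerivAt_sqrt_two_mul {t : ℝ} (ht : 0 < t) :
    HasDerivAt (fun t : ℝ => Real.sqrt (2 * t)) (Real.sqrt (2 * t))⁻¹ t := by
  have h := ((hasDerivAt_id t).const_mul 2).sqrt (by simp [ht.ne'])
  refine h.congr_deriv ?_
  simp only [id, mul_one]
  rw [div_mul_cancel_left₀ two_ne_zero]

theorem deriv_sqrt_two_mul_smul_comp_div {E : Type*} [NormedAddCommGroup E] [NormedSpace ℝ E]
    {f : ℝ → E} (hf : Differentiable ℝ f) {t : ℝ} (ht : 0 < t) (x : ℝ) :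
    deriv (fun t' : ℝ => Real.sqrt (2 * t') • f (x / Real.sqrt (2 * t'))) t =
      (Real.sqrt (2 * t))⁻¹ • (f (x / Real.sqrt (2 * t)) -
        (x / Real.sqrt (2 * t)) • deriv f (x / Real.sqrt (2 * t))) := by
  have hr : Real.sqrt (2 * t) ≠ 0 := by positivity
  have h := hasDerivAt_sqrt_two_mul ht
  have hdiv := (hasDerivAt_const t x).fun_div h hr
  have hcomp := (hf (x / Real.sqrt (2 * t))).hasDerivAt.scomp t hdiv
  refine (h.fun_smul hcomp).deriv.trans ?_
  simp only [Function.comp_apply]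
  match_scalars <;> (field_simp; try ring)

/-- Self-similar solutions: `γ(t,x) = √(2t)·η(x/√(2t))` solves the parametrized
curve-shortening flow `∂_t γ = ∂²_x γ / ‖∂_x γ‖²` for `t > 0` if and only if
`η` solves the expander ODE `η''/‖η'‖² + s·η' − η = 0`. -/
theorem selfsimilar_iff_expander
    (η : ℝ → EuclideanSpace ℝ (Fin 2))
    (hη : ContDiff ℝ 2 η)
    (hreg : ∀ s : ℝ, deriv η s ≠ 0) :
    (∀ t : ℝ, 0 < t → ∀ x : ℝ,
      deriv (fun t' : ℝ => Real.sqrt (2 * t') • η (x / Real.sqrt (2 * t'))) t =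
        (‖deriv (fun x' : ℝ => Real.sqrt (2 * t) • η (x' / Real.sqrt (2 * t))) x‖ ^ 2)⁻¹ •
          deriv (deriv (fun x' : ℝ => Real.sqrt (2 * t) • η (x' / Real.sqrt (2 * t)))) x)
    ↔ (∀ s : ℝ, (‖deriv η s‖ ^ 2)⁻¹ • deriv (deriv η) s + s • deriv η s - η s = 0) := by
  have key : ∀ t : ℝ, 0 < t → ∀ x : ℝ,
      (deriv (fun t' : ℝ => Real.sqrt (2 * t') • η (x / Real.sqrt (2 * t'))) t =
        (‖deriv (fun x' : ℝ => Real.sqrt (2 * t) • η (x' / Real.sqrt (2 * t))) x‖ ^ 2)⁻¹ •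
          deriv (deriv (fun x' : ℝ => Real.sqrt (2 * t) • η (x' / Real.sqrt (2 * t)))) x) ↔
      (‖deriv η (x / Real.sqrt (2 * t))‖ ^ 2)⁻¹ • deriv (deriv η) (x / Real.sqrt (2 * t)) +
        (x / Real.sqrt (2 * t)) • deriv η (x / Real.sqrt (2 * t)) -
          η (x / Real.sqrt (2 * t)) = 0 := by
    intro t ht x
    have hr : Real.sqrt (2 * t) ≠ 0 := by positivity
    rw [deriv_sqrt_two_mul_smul_comp_div (hη.differentiable (by norm_num)) ht,
      deriv_smul_comp_div η hr, deriv_comp_div_const, smul_comm _ (Real.sqrt (2 * t))⁻¹,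
      (smul_right_injective _ (inv_ne_zero hr)).eq_iff, sub_eq_iff_eq_add, sub_eq_zero, eq_comm]
  constructor
  · intro h s
    simpa using (key (1 / 2) (by norm_num) s).1 (h _ (by norm_num) s)
  · intro h t ht x
    exact (key t ht x).2 (h _)
end

section
/- Let j be a natural number and let v : ℝ → ℝ be infinitely differentiable with v''(s) + s·v'(s) = j·v(s) for all s. Then the (j+1)-st derivative satisfies v^{(j+1)}(s) = v^{(j+1)}(0)·exp(−s²/2) for all s ∈ ℝ. In particular, if v^{(j+1)}(0) = 0, then v is a polynomial of degree at most j. -/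
open Set

/-- Every real polynomial of degree less than `n` has an antiderivative of degree less than
`n + 1` with prescribed value at `0`. -/
theorem Polynomial.exists_derivative_eq_of_degree_lt {n : ℕ} (P : Polynomial ℝ)
    (hP : P.degree < n) (c : ℝ) :
    ∃ Q : Polynomial ℝ, Q.degree < (n + 1 : ℕ) ∧ Q.derivative = P ∧ Q.eval 0 = c := by
  refine ⟨∑ i ∈ Finset.range n, Polynomial.monomial (i + 1) (P.coeff i / (i + 1)) +
    Polynomial.C c, ?_, ?_, ?_⟩
  · rw [← Polynomial.mem_degreeLT]
    refine add_mem (sum_mem fun i hi => ?_) ?_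
    · rw [Polynomial.mem_degreeLT]
      refine (Polynomial.degree_monomial_le _ _).trans_lt ?_
      exact_mod_cast Nat.succ_lt_succ (Finset.mem_range.mp hi)
    · rw [Polynomial.mem_degreeLT]
      exact Polynomial.degree_C_le.trans_lt (by exact_mod_cast n.succ_pos)
  · have hcoeff (i : ℕ) : P.coeff i / ((i : ℝ) + 1) * ((i : ℝ) + 1) = P.coeff i :=
      div_mul_cancel₀ _ (by positivity)
    ext k
    simp only [Polynomial.derivative_add, Polynomial.derivative_sum,
      Polynomial.derivative_monomial, Polynomial.derivative_C, add_zero, Nat.cast_add,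
      Nat.cast_one, add_tsub_cancel_right, hcoeff, Polynomial.finsetSum_coeff,
      Polynomial.coeff_monomial, Finset.sum_ite_eq', Finset.mem_range]
    split_ifs with hk
    · rfl
    · exact (Polynomial.coeff_eq_zero_of_degree_lt
        (hP.trans_le (by exact_mod_cast not_lt.mp hk))).symm
  · simp [Polynomial.eval_finsetSum]

/-- A smooth function whose `n`-th derivative vanishes is a polynomial of degree less than `n`. -/
theorem exists_polynomial_of_iteratedDeriv_eq_zero (n : ℕ) {f : ℝ → ℝ}
    (hf : ContDiff ℝ (⊤ : ℕ∞) f) (h : ∀ s, iteratedDeriv n f s = 0) :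
    ∃ P : Polynomial ℝ, P.degree < n ∧ ∀ s, f s = P.eval s := by
  induction n generalizing f with
  | zero => exact ⟨0, by simp, fun s => by simpa using h s⟩
  | succ n ih =>
    obtain ⟨hd, hf'⟩ := contDiff_infty_iff_deriv.mp hf
    obtain ⟨P, hP, hPf⟩ := ih hf' fun s => by rw [← iteratedDeriv_succ']; exact h s
    obtain ⟨Q, hQ, hQP, hQ0⟩ := P.exists_derivative_eq_of_degree_lt hP (f 0)
    refine ⟨Q, hQ, fun s => ?_⟩
    have hconst := is_const_of_deriv_eq_zero (f := fun t => f t - Q.eval t)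
      (hd.sub Q.differentiable) (fun t => by
        rw [deriv_fun_sub hd.differentiableAt Q.differentiableAt, Polynomial.deriv, hQP, hPf,
          sub_self]) s 0
    simpa [hQ0, sub_eq_zero] using hconst

/-- Solutions of `w' + s·w = 0` are multiples of `exp (-s² / 2)`. -/
theorem eq_mul_exp_of_deriv_add_mul_eq_zero {w : ℝ → ℝ} (hw : Differentiable ℝ w)
    (h : ∀ s, deriv w s + s * w s = 0) (s : ℝ) : w s = w 0 * Real.exp (-s ^ 2 / 2) := by
  have hderiv (t : ℝ) : HasDerivAt (fun t => w t * Real.exp (t ^ 2 / 2)) 0 t := by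
    have he : HasDerivAt (fun t : ℝ => t ^ 2 / 2) t t := by
      simpa using (hasDerivAt_pow 2 t).div_const 2
    refine ((hw t).hasDerivAt.mul he.exp).congr_deriv ?_
    linear_combination Real.exp (t ^ 2 / 2) * h t
  have hconst := is_const_of_deriv_eq_zero (fun t => (hderiv t).differentiableAt)
    (fun t => (hderiv t).deriv) s 0
  have hexp : Real.exp (s ^ 2 / 2) * Real.exp (-s ^ 2 / 2) = 1 := by
    rw [← Real.exp_add, neg_div, add_neg_cancel, Real.exp_zero]
  simp only [ne_eq, OfNat.ofNat_ne_zero, not_false_eq_true, zero_pow, zero_div, Real.exp_zero,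
    mul_one] at hconst
  rw [← hconst, mul_assoc, hexp, mul_one]

/-- The intertwining identity `(v'' + s·v' - c·v)' = (v')'' + s·(v')' - (c - 1)·v'`, for
solutions of the homogeneous equation. -/
theorem deriv_deriv_add_mul_deriv_of_intertwining {c : ℝ} {v : ℝ → ℝ}
    (hv : ContDiff ℝ (⊤ : ℕ∞) v) (hode : ∀ s, deriv (deriv v) s + s * deriv v s = c * v s)
    (s : ℝ) :
    deriv (deriv (deriv v)) s + s * deriv (deriv v) s = (c - 1) * deriv v s := by
  obtain ⟨hd, hv'⟩ := contDiff_infty_iff_deriv.mp hv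
  obtain ⟨hd', hv''⟩ := contDiff_infty_iff_deriv.mp hv'
  have hd'' := (contDiff_infty_iff_deriv.mp hv'').1
  have hlhs := (hd'' s).hasDerivAt.add ((hasDerivAt_id s).mul (hd' s).hasDerivAt)
  have hrhs := (hd s).hasDerivAt.const_mul c
  have heq : deriv (deriv v) + id * deriv v = fun t => c * v t := funext hode
  rw [heq] at hlhs
  have := hlhs.unique hrhs
  simp only [id_eq] at this
  linear_combination this

theorem iteratedDeriv_succ_eq_mul_exp (j : ℕ) {v : ℝ → ℝ} (hv : ContDiff ℝ (⊤ : ℕ∞) v)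
    (hode : ∀ s, deriv (deriv v) s + s * deriv v s = j * v s) (s : ℝ) :
    iteratedDeriv (j + 1) v s = iteratedDeriv (j + 1) v 0 * Real.exp (-s ^ 2 / 2) := by
  induction j generalizing v with
  | zero =>
    rw [zero_add, iteratedDeriv_one]
    exact eq_mul_exp_of_deriv_add_mul_eq_zero
      (contDiff_infty_iff_deriv.mp (contDiff_infty_iff_deriv.mp hv).2).1
      (fun t => by simpa using hode t) s
  | succ j ih =>
    rw [iteratedDeriv_succ' (n := j + 1)]
    refine ih (contDiff_infty_iff_deriv.mp hv).2 fun t => ?_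
    simpa using deriv_deriv_add_mul_deriv_of_intertwining hv hode t

/-- Intertwining identity consequence: if `v` is smooth with `v'' + s·v' = j·v`, then
`v^{(j+1)}(s) = v^{(j+1)}(0)·exp(−s²/2)`; in particular, if `v^{(j+1)}(0) = 0` then `v`
is a polynomial of degree at most `j`. -/
theorem intertwining_gaussian
    (j : ℕ) (v : ℝ → ℝ) (hv : ContDiff ℝ (⊤ : ℕ∞) v)
    (hode : ∀ s : ℝ, deriv (deriv v) s + s * deriv v s = j * v s) :
    (∀ s : ℝ, iteratedDeriv (j + 1) v s = iteratedDeriv (j + 1) v 0 * Real.exp (-s ^ 2 / 2)) ∧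
    (iteratedDeriv (j + 1) v 0 = 0 →
      ∃ P : Polynomial ℝ, P.degree ≤ (j : WithBot ℕ) ∧ ∀ s : ℝ, v s = P.eval s) := by
  have hmain := iteratedDeriv_succ_eq_mul_exp j hv hode
  refine ⟨hmain, fun h0 => ?_⟩
  obtain ⟨P, hP, hPv⟩ := exists_polynomial_of_iteratedDeriv_eq_zero (j + 1) hv fun s => by
    rw [hmain, h0, zero_mul]
  refine ⟨P, (Polynomial.degree_le_iff_coeff_zero P j).mpr fun m hm => ?_, hPv⟩
  exact (Polynomial.degree_lt_iff_coeff_zero P (j + 1)).mp hP m (by exact_mod_cast hm)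
end

section
/- Let j ≥ 0 be a real number and let v : [0,∞) → ℝ be twice continuously differentiable with v''(s) + s·v'(s) − j·v(s) = 0 for all s ≥ 0, v(0) = 0, and suppose v and v' are square-integrable on [0,∞), v(s)·v'(s) → 0 as s → ∞, and s·v(s)² → 0 as s → ∞. Then v ≡ 0. Indeed, ∫₀^∞ (v'(s))² ds + (j + 1/2)·∫₀^∞ v(s)² ds = 0. -/
open Set MeasureTheory

/-- Uniqueness for `L_j v = v'' + s·v' − j·v = 0` with `v(0) = 0` and decay:
such a solution vanishes identically, and indeed
`∫₀^∞ (v')² + (j + 1/2)·∫₀^∞ v² = 0`. -/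
theorem Lj_vanishing
    (j : ℝ) (hj : 0 ≤ j) (v v' v'' : ℝ → ℝ)
    (h1 : ∀ s ∈ Ici (0:ℝ), HasDerivWithinAt v (v' s) (Ici 0) s)
    (h2 : ∀ s ∈ Ici (0:ℝ), HasDerivWithinAt v' (v'' s) (Ici 0) s)
    (hcont : ContinuousOn v'' (Ici 0))
    (hode : ∀ s ∈ Ici (0:ℝ), v'' s + s * v' s - j * v s = 0)
    (hv0 : v 0 = 0)
    (hL2v : IntegrableOn (fun s => (v s) ^ 2) (Ioi 0))
    (hL2v' : IntegrableOn (fun s => (v' s) ^ 2) (Ioi 0))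
    (hlim1 : Filter.Tendsto (fun s => v s * v' s) Filter.atTop (nhds 0))
    (hlim2 : Filter.Tendsto (fun s => s * (v s) ^ 2) Filter.atTop (nhds 0)) :
    (∀ s ∈ Ici (0:ℝ), v s = 0) ∧
    (∫ s in Ioi (0:ℝ), (v' s) ^ 2) + (j + 1/2) * (∫ s in Ioi (0:ℝ), (v s) ^ 2) = 0 := by
  let F : ℝ → ℝ := fun s => v s * v' s + s * (v s) ^ 2 / 2
  let F' : ℝ → ℝ := fun s => (v' s) ^ 2 + (j + 1/2) * (v s) ^ 2
  have hF : ∀ s ∈ Ici (0:ℝ), HasDerivWithinAt F (F' s) (Ici 0) s := by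
    intro s hs
    have h := ((h1 s hs).mul (h2 s hs)).add
      (((hasDerivWithinAt_id s (Ici 0)).mul ((h1 s hs).pow 2)).div_const 2)
    refine h.congr_deriv ?_
    have e : v'' s = j * v s - s * v' s := by linarith [hode s hs]
    simp only [F', e, id, Pi.pow_apply]
    push_cast
    ring
  have hF'nonneg : ∀ s, 0 ≤ F' s := fun s => by positivity
  have hF0 : F 0 = 0 := by simp [F, hv0]
  have hFlim : Filter.Tendsto F Filter.atTop (nhds 0) := by
    simpa [F] using hlim1.add (hlim2.div_const 2)
  have hFcont : ContinuousOn F (Ici 0) := fun s hs => (hF s hs).continuousWithinAt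
  have hFderiv : ∀ s ∈ Ioi (0:ℝ), HasDerivAt F (F' s) s := fun s hs =>
    (hF s (mem_Ici_of_Ioi hs)).hasDerivAt (Ici_mem_nhds hs)
  refine ⟨fun s hs => ?_, ?_⟩
  · have hmono : MonotoneOn F (Ici 0) := by
      refine monotoneOn_of_hasDerivWithinAt_nonneg (f' := F') (convex_Ici 0) hFcont ?_
        fun x _ => hF'nonneg x
      intro x hx
      rw [interior_Ici] at hx
      exact (hFderiv x hx).hasDerivWithinAt
    have hFzero : ∀ t ∈ Ici (0:ℝ), F t = 0 := by
      intro t ht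
      refine le_antisymm (ge_of_tendsto hFlim ?_) ?_
      · filter_upwards [Filter.eventually_ge_atTop t] with u hu
        exact hmono ht (mem_Ici.2 (le_trans ht hu)) hu
      · simpa [hF0] using hmono self_mem_Ici ht ht
    have hF's : F' s = 0 :=
      (uniqueDiffOn_Ici 0 s hs).eq_deriv _ (hF s hs)
        ((hasDerivWithinAt_const s (Ici 0) (0:ℝ)).congr hFzero (hFzero s hs))
    have hsq : (v s) ^ 2 = 0 := by
      simp only [F'] at hF's
      nlinarith [sq_nonneg (v s), sq_nonneg (v' s), mul_nonneg hj (sq_nonneg (v s))]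
    exact pow_eq_zero_iff two_ne_zero |>.1 hsq
  · have h := integral_Ioi_of_hasDerivAt_of_tendsto (hFcont 0 self_mem_Ici) hFderiv
      (hL2v'.add (hL2v.const_mul (j + 1/2))) hFlim
    rw [hF0, sub_zero, integral_add hL2v' (hL2v.const_mul (j + 1/2)),
      integral_const_mul] at h
    exact h
end

section
/- Let n ≥ 1 be a natural number, let R be a real polynomial of degree at most n − 2 (or R = 0), and let a ∈ ℝ. Then there exists a unique real polynomial P of degree at most n whose coefficient of s^n equals a and which satisfies P''(s) + s·P'(s) − n·P(s) = R(s) identically. Moreover, the coefficient of s^{n−1} in P equals 0. -/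
open Polynomial

/-- The coefficients of `P'' + X * P' - n * P`. -/
lemma coeff_derivative_derivative_add_X_mul_derivative_sub (n l : ℕ) (P : ℝ[X]) :
    (derivative (derivative P) + X * derivative P - C (n : ℝ) * P).coeff l =
      (l + 2) * (l + 1) * P.coeff (l + 2) + ((l : ℝ) - n) * P.coeff l := by
  rcases l with _ | l
  · simp [coeff_derivative]
    ring
  · simp [coeff_derivative, coeff_X_mul]
    ring

/-- The differential equation, required at every point, is an identity of coefficients. -/
lemma eval_hermite_type_eq_iff_coeff (n : ℕ) (P R : ℝ[X]) :
    (∀ s : ℝ, (derivative (derivative P)).eval s + s * (derivative P).eval s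
        - (n : ℝ) * P.eval s = R.eval s) ↔
      ∀ l : ℕ, ((l : ℝ) + 2) * (l + 1) * P.coeff (l + 2) + ((l : ℝ) - n) * P.coeff l =
        R.coeff l := by
  simp_rw [← coeff_derivative_derivative_add_X_mul_derivative_sub, ← Polynomial.ext_iff]
  constructor
  · intro h
    refine Polynomial.funext fun s => ?_
    simpa using h s
  · rintro rfl s
    simp

/-- Below degree `n`, the recursion for the coefficients is solvable. -/
lemma exists_coeff_recursion (n m : ℕ) (hm : m ≤ n) (R : ℝ[X])
    (hR : ∀ l, m ≤ l → R.coeff l = 0) :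
    ∃ Q : ℝ[X], (∀ l, m ≤ l → Q.coeff l = 0) ∧
      ∀ l : ℕ, ((l : ℝ) + 2) * (l + 1) * Q.coeff (l + 2) + ((l : ℝ) - n) * Q.coeff l =
        R.coeff l := by
  induction m generalizing R with
  | zero => exact ⟨0, by simp, fun l => by simp [hR l]⟩
  | succ m ih =>
    have hne : (m : ℝ) - n ≠ 0 := by
      rw [sub_ne_zero]
      exact_mod_cast (by omega : m ≠ n)
    set T : ℝ[X] := monomial m (R.coeff m / (m - n)) with hT
    set S : ℝ[X] := derivative (derivative T) + X * derivative T - C (n : ℝ) * T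
    have hTc (l : ℕ) : S.coeff l =
        ((l : ℝ) + 2) * (l + 1) * T.coeff (l + 2) + ((l : ℝ) - n) * T.coeff l :=
      coeff_derivative_derivative_add_X_mul_derivative_sub n l T
    obtain ⟨Q, hQ, hrec⟩ := ih (by omega) (R - S) fun l hl => by
      have h2 : m ≠ l + 2 := by omega
      rw [coeff_sub, hTc, hT, coeff_monomial, coeff_monomial, if_neg h2]
      rcases eq_or_lt_of_le hl with rfl | hl
      · simp [mul_div_cancel₀ _ hne]
      · simp [hl.ne, hR l hl]
    refine ⟨Q + T, fun l hl => ?_, fun l => ?_⟩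
    · rw [coeff_add, hQ l (by omega), hT, coeff_monomial, if_neg (by omega), add_zero]
    · have := hrec l
      rw [coeff_sub, hTc] at this
      rw [coeff_add, coeff_add]
      linarith

/-- A polynomial of degree less than `n` solving the homogeneous recursion is zero. -/
lemma eq_zero_of_coeff_recursion (n : ℕ) (Q : ℝ[X]) (hQ : Q.degree < n)
    (h : ∀ l : ℕ, ((l : ℝ) + 2) * (l + 1) * Q.coeff (l + 2) + ((l : ℝ) - n) * Q.coeff l = 0) :
    Q = 0 := by
  by_contra h0
  have hlt : Q.natDegree < n := (natDegree_lt_iff_degree_lt h0).2 hQ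
  have h1 := h Q.natDegree
  rw [coeff_eq_zero_of_natDegree_lt (by omega : Q.natDegree < Q.natDegree + 2), mul_zero,
    zero_add, mul_eq_zero, sub_eq_zero] at h1
  rcases h1 with h1 | h1
  · exact hlt.ne (by exact_mod_cast h1)
  · exact h0 (leadingCoeff_eq_zero.1 h1)

/-- Given `n ≥ 1`, a real polynomial `R` of degree at most `n − 2` (possibly `R = 0`),
and `a ∈ ℝ`, there is a unique real polynomial `P` of degree at most `n`, with
coefficient of `s^n` equal to `a`, satisfying `P'' + s·P' − n·P = R` identically.
Moreover the coefficient of `s^{n−1}` in `P` vanishes.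
(The hypothesis `R.degree + 2 ≤ n` encodes `deg R ≤ n − 2` and holds automatically
when `R = 0` since `degree 0 = ⊥`.) -/
theorem poly_part_unique (n : ℕ) (hn : 1 ≤ n) (R : Polynomial ℝ)
    (hR : R.degree + 2 ≤ (n : WithBot ℕ)) (a : ℝ) :
    (∃! P : Polynomial ℝ, P.degree ≤ (n : WithBot ℕ) ∧ P.coeff n = a ∧
      ∀ s : ℝ, (derivative (derivative P)).eval s + s * (derivative P).eval s
        - (n : ℝ) * P.eval s = R.eval s) ∧
    (∀ P : Polynomial ℝ, P.degree ≤ (n : WithBot ℕ) → P.coeff n = a →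
      (∀ s : ℝ, (derivative (derivative P)).eval s + s * (derivative P).eval s
        - (n : ℝ) * P.eval s = R.eval s) →
      P.coeff (n - 1) = 0) := by
  have hRc (l : ℕ) (hl : n ≤ l + 1) : R.coeff l = 0 := by
    by_contra hne
    have h1 : ((l : WithBot ℕ) + 2) ≤ n := (add_le_add_left (le_degree_of_ne_zero hne) 2).trans hR
    have h2 : l + 2 ≤ n := by exact_mod_cast h1
    omega
  simp_rw [eval_hermite_type_eq_iff_coeff]
  refine ⟨?_, ?_⟩
  · set T : ℝ[X] := monomial n a with hT
    set S : ℝ[X] := derivative (derivative T) + X * derivative T - C (n : ℝ) * T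
    have hTc (l : ℕ) : S.coeff l =
        ((l : ℝ) + 2) * (l + 1) * T.coeff (l + 2) + ((l : ℝ) - n) * T.coeff l :=
      coeff_derivative_derivative_add_X_mul_derivative_sub n l T
    obtain ⟨Q, hQ, hrec⟩ := exists_coeff_recursion n n le_rfl (R - S) fun l hl => by
      have h2 : n ≠ l + 2 := by omega
      rw [coeff_sub, hTc, hRc l (by omega), hT, coeff_monomial, coeff_monomial, if_neg h2]
      rcases eq_or_lt_of_le hl with rfl | hl
      · simp
      · simp [hl.ne]
    refine ⟨Q + T, ⟨?_, ?_, fun l => ?_⟩, ?_⟩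
    · rw [degree_le_iff_coeff_zero]
      intro l hl
      have hl : n < l := by exact_mod_cast hl
      rw [coeff_add, hQ l hl.le, hT, coeff_monomial, if_neg hl.ne, add_zero]
    · simp [hQ n le_rfl, hT]
    · have := hrec l
      rw [coeff_sub, hTc] at this
      rw [coeff_add, coeff_add]
      linarith
    · rintro P ⟨hdeg, hcoeff, hP⟩
      rw [← sub_eq_zero]
      refine eq_zero_of_coeff_recursion n _ ?_ fun l => ?_
      · rw [degree_lt_iff_coeff_zero]
        intro l hl
        rw [coeff_sub, coeff_add, hQ l hl, hT, coeff_monomial]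
        rcases eq_or_lt_of_le hl with rfl | hl
        · simp [hcoeff]
        · rw [coeff_eq_zero_of_degree_lt (hdeg.trans_lt (by exact_mod_cast hl)), if_neg hl.ne]
          simp
      · have h1 := hP l
        have h2 := hrec l
        rw [coeff_sub, hTc] at h2
        simp only [coeff_sub, coeff_add]
        linarith
  · intro P hdeg _ hP
    have h1 := hP (n - 1)
    have h2 : n < n - 1 + 2 := by omega
    rw [hRc _ (by omega), coeff_eq_zero_of_degree_lt (hdeg.trans_lt (by exact_mod_cast h2)),
      Nat.cast_sub hn] at h1
    push_cast at h1
    linarith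
end

section
/- There exists an absolute constant C > 0 with the following property. Let u : ℝ² → ℝ be smooth with compact support contained in {(τ,s) : τ > 0 and s > 1}, let N ≥ 1 be real, and define h(τ,s) = τ^{−2}·( τ·∂_τ u − ∂²_s u − s·∂_s u + N·u )(τ,s) on {τ > 0}. Then N·∬ (∂_s u)² dτ ds + N²·∬ u² dτ ds ≤ C·∬ τ⁴·h² dτ ds, where all integrals are over (0,∞)×(1,∞). -/
open Set MeasureTheory

/-- Partial derivative in the first variable. -/
noncomputable def pd1 (u : ℝ × ℝ → ℝ) (p : ℝ × ℝ) : ℝ :=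
  deriv (fun t => u (t, p.2)) p.1

/-- Partial derivative in the second variable. -/
noncomputable def pd2 (u : ℝ × ℝ → ℝ) (p : ℝ × ℝ) : ℝ :=
  deriv (fun s => u (p.1, s)) p.2

theorem hasDerivAt_pd1 {u : ℝ × ℝ → ℝ} (hu : Differentiable ℝ u) (p : ℝ × ℝ) :
    HasDerivAt (fun t => u (t, p.2)) (pd1 u p) p.1 := by
  have : Differentiable ℝ (fun t => u (t, p.2)) := by fun_prop
  exact (this p.1).hasDerivAt

theorem hasDerivAt_pd2 {u : ℝ × ℝ → ℝ} (hu : Differentiable ℝ u) (p : ℝ × ℝ) :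
    HasDerivAt (fun s => u (p.1, s)) (pd2 u p) p.2 := by
  have : Differentiable ℝ (fun s => u (p.1, s)) := by fun_prop
  exact (this p.2).hasDerivAt

theorem pd1_eq_fderiv {u : ℝ × ℝ → ℝ} (hu : Differentiable ℝ u) :
    pd1 u = fun p => fderiv ℝ u p (1, 0) := by
  funext p
  exact ((hu (p.1, p.2)).hasFDerivAt.comp_hasDerivAt p.1
    ((hasDerivAt_id p.1).prodMk (hasDerivAt_const p.1 p.2))).deriv

theorem pd2_eq_fderiv {u : ℝ × ℝ → ℝ} (hu : Differentiable ℝ u) :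
    pd2 u = fun p => fderiv ℝ u p (0, 1) := by
  funext p
  exact ((hu (p.1, p.2)).hasFDerivAt.comp_hasDerivAt p.2
    ((hasDerivAt_const p.2 p.1).prodMk (hasDerivAt_id p.2))).deriv

theorem contDiff_fderiv_const {u : ℝ × ℝ → ℝ} (hu : ContDiff ℝ (⊤ : ℕ∞) u) (v : ℝ × ℝ) :
    ContDiff ℝ (⊤ : ℕ∞) (fun p => fderiv ℝ u p v) :=
  (hu.fderiv_right (by simp)).clm_apply contDiff_const

/-- The directional derivatives of a compactly supported function have vanishing integral. -/
theorem setIntegral_fderiv_eq_zero {g : ℝ × ℝ → ℝ} {S : Set (ℝ × ℝ)}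
    (hg : ContDiff ℝ (⊤ : ℕ∞) g) (hc : HasCompactSupport g) (hS : tsupport g ⊆ S) (v : ℝ × ℝ) :
    ∫ p in S, fderiv ℝ g p v = 0 := by
  rw [setIntegral_eq_integral_of_forall_compl_eq_zero]
  · have h1 : Integrable (fun p => fderiv ℝ g p v) :=
      (contDiff_fderiv_const hg v).continuous.integrable_of_hasCompactSupport (hc.fderiv_apply ℝ v)
    have h2 : Integrable g := hg.continuous.integrable_of_hasCompactSupport hc
    have := integral_mul_fderiv_eq_neg_fderiv_mul_of_integrable (μ := (volume : Measure (ℝ × ℝ)))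
      (f := fun _ => (1 : ℝ)) (g := g) (v := v) (by simp) (by simpa using h1) (by simpa using h2)
      (fun _ _ => by fun_prop) (fun x _ => (hg.differentiable (by simp)) x)
    simpa using this
  · intro p hp
    by_contra h
    exact hp (hS (tsupport_fderiv_apply_subset ℝ v (subset_tsupport _ h)))

/-- First energy estimate for the model operator `τ∂_τ − ∂²_s − s∂_s + N` near the
corner of the front and bottom faces: if `h = τ^{−2}(τ∂_τ u − ∂²_s u − s∂_s u + Nu)`
for `u` smooth and compactly supported in `{τ > 0, s > 1}` and `N ≥ 1`, then
`N ∬ (∂_s u)² + N² ∬ u² ≤ C ∬ τ⁴ h²`. -/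
theorem model_energy_estimate_I :
    ∃ C : ℝ, 0 < C ∧
      ∀ (u h : ℝ × ℝ → ℝ) (N : ℝ), 1 ≤ N →
        ContDiff ℝ (⊤ : ℕ∞) u → HasCompactSupport u →
        tsupport u ⊆ {p : ℝ × ℝ | 0 < p.1 ∧ 1 < p.2} →
        (∀ p : ℝ × ℝ, 0 < p.1 →
          h p = (p.1 ^ 2)⁻¹ *
            (p.1 * pd1 u p - pd2 (pd2 u) p - p.2 * pd2 u p + N * u p)) →
        N * (∫ p in Ioi (0:ℝ) ×ˢ Ioi (1:ℝ), (pd2 u p) ^ 2) +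
          N ^ 2 * (∫ p in Ioi (0:ℝ) ×ˢ Ioi (1:ℝ), (u p) ^ 2) ≤
          C * ∫ p in Ioi (0:ℝ) ×ˢ Ioi (1:ℝ), p.1 ^ 4 * (h p) ^ 2 := by
  refine ⟨1, one_pos, fun u h N hN hu hc hS hh => ?_⟩
  have hSeq : {p : ℝ × ℝ | 0 < p.1 ∧ 1 < p.2} = Ioi (0:ℝ) ×ˢ Ioi (1:ℝ) := by
    ext p; simp
  rw [hSeq] at hS
  have hmeas : MeasurableSet (Ioi (0:ℝ) ×ˢ Ioi (1:ℝ)) := measurableSet_Ioi.prod measurableSet_Ioi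
  have hsq : ∫ p in Ioi (0:ℝ) ×ˢ Ioi (1:ℝ), p.1 ^ 4 * (h p) ^ 2 =
      ∫ p in Ioi (0:ℝ) ×ˢ Ioi (1:ℝ),
        (p.1 * pd1 u p - pd2 (pd2 u) p - p.2 * pd2 u p + N * u p) ^ 2 := by
    refine setIntegral_congr_fun hmeas fun p hp => ?_
    have hp0 : 0 < p.1 := hp.1
    simp only [hh p hp0]
    field_simp
  have hud := hu.differentiable (by simp)
  have hu1 : ContDiff ℝ (⊤ : ℕ∞) (pd1 u) := pd1_eq_fderiv hud ▸ contDiff_fderiv_const hu _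
  have hu2 : ContDiff ℝ (⊤ : ℕ∞) (pd2 u) := pd2_eq_fderiv hud ▸ contDiff_fderiv_const hu _
  have hu2d := hu2.differentiable (by simp)
  have hu22 : ContDiff ℝ (⊤ : ℕ∞) (pd2 (pd2 u)) :=
    pd2_eq_fderiv hu2d ▸ contDiff_fderiv_const hu2 _
  have hc1 : HasCompactSupport (pd1 u) := pd1_eq_fderiv hud ▸ hc.fderiv_apply ℝ _
  have hc2 : HasCompactSupport (pd2 u) := pd2_eq_fderiv hud ▸ hc.fderiv_apply ℝ _
  have hc22 : HasCompactSupport (pd2 (pd2 u)) := pd2_eq_fderiv hu2d ▸ hc2.fderiv_apply ℝ _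
  set A : ℝ × ℝ → ℝ := fun p => u p * (p.1 * u p / 2)
  set B : ℝ × ℝ → ℝ := fun p => u p * (pd2 u p + p.2 * u p / 2)
  have hAs : ContDiff ℝ (⊤ : ℕ∞) A := by fun_prop
  have hBs : ContDiff ℝ (⊤ : ℕ∞) B := by fun_prop
  have hAc : HasCompactSupport A := hc.mul_right
  have hBc : HasCompactSupport B := hc.mul_right
  have hAd := hAs.differentiable (by simp)
  have hBd := hBs.differentiable (by simp)
  have hA1 (p : ℝ × ℝ) : pd1 A p = u p ^ 2 / 2 + p.1 * u p * pd1 u p := by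
    have h1 := hasDerivAt_pd1 hud p
    refine ((h1.mul (((hasDerivAt_id p.1).mul h1).div_const 2)).deriv).trans ?_
    simp; ring
  have hB2 (p : ℝ × ℝ) : pd2 B p =
      pd2 u p ^ 2 + u p * pd2 (pd2 u) p + u p ^ 2 / 2 + p.2 * u p * pd2 u p := by
    have h1 := hasDerivAt_pd2 hud p
    refine ((h1.mul ((hasDerivAt_pd2 hu2d p).add
      (((hasDerivAt_id p.2).mul h1).div_const 2))).deriv).trans ?_
    simp; ring
  have hAi : ∫ p in Ioi (0:ℝ) ×ˢ Ioi (1:ℝ), pd1 A p = 0 := by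
    rw [pd1_eq_fderiv hAd]
    exact setIntegral_fderiv_eq_zero hAs hAc ((tsupport_mul_subset_left).trans hS) _
  have hBi : ∫ p in Ioi (0:ℝ) ×ˢ Ioi (1:ℝ), pd2 B p = 0 := by
    rw [pd2_eq_fderiv hBd]
    exact setIntegral_fderiv_eq_zero hBs hBc ((tsupport_mul_subset_left).trans hS) _
  have integrableOn_of_support {g : ℝ × ℝ → ℝ} (h1 : Continuous g) (h2 : HasCompactSupport g) :
      IntegrableOn g (Ioi (0:ℝ) ×ˢ Ioi (1:ℝ)) :=
    (h1.integrable_of_hasCompactSupport h2).integrableOn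
  have hcont := hu.continuous
  have hcont1 := hu1.continuous
  have hcont2 := hu2.continuous
  have hcont22 := hu22.continuous
  have iA : IntegrableOn (pd1 A) (Ioi (0:ℝ) ×ˢ Ioi (1:ℝ)) := by
    rw [pd1_eq_fderiv hAd]
    exact integrableOn_of_support (contDiff_fderiv_const hAs _).continuous (hAc.fderiv_apply ℝ _)
  have iB : IntegrableOn (pd2 B) (Ioi (0:ℝ) ×ˢ Ioi (1:ℝ)) := by
    rw [pd2_eq_fderiv hBd]
    exact integrableOn_of_support (contDiff_fderiv_const hBs _).continuous (hBc.fderiv_apply ℝ _)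
  have iu : IntegrableOn (fun p => u p ^ 2) (Ioi (0:ℝ) ×ˢ Ioi (1:ℝ)) :=
    integrableOn_of_support (by fun_prop) (hc.comp_left (g := fun x : ℝ => x ^ 2) (by simp))
  have iu2 : IntegrableOn (fun p => pd2 u p ^ 2) (Ioi (0:ℝ) ×ˢ Ioi (1:ℝ)) :=
    integrableOn_of_support (by fun_prop) (hc2.comp_left (g := fun x : ℝ => x ^ 2) (by simp))
  have iF : IntegrableOn (fun p : ℝ × ℝ =>
      (p.1 * pd1 u p - pd2 (pd2 u) p - p.2 * pd2 u p + N * u p) ^ 2)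
      (Ioi (0:ℝ) ×ˢ Ioi (1:ℝ)) :=
    integrableOn_of_support (by fun_prop)
      ((((hc1.mul_left.sub hc22).sub hc2.mul_left).add hc.mul_left).comp_left
        (g := fun x : ℝ => x ^ 2) (by simp))
  have iD : IntegrableOn (fun p => 2 * N * (pd1 A p - pd2 B p)) (Ioi (0:ℝ) ×ˢ Ioi (1:ℝ)) :=
    (iA.sub iB).const_mul _
  rw [hsq, one_mul, ← integral_const_mul, ← integral_const_mul,
    ← integral_add (iu2.const_mul N) (iu.const_mul _)]
  calc _ ≤ ∫ p in Ioi (0:ℝ) ×ˢ Ioi (1:ℝ),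
        ((p.1 * pd1 u p - pd2 (pd2 u) p - p.2 * pd2 u p + N * u p) ^ 2 -
          2 * N * (pd1 A p - pd2 B p)) := by
        refine integral_mono ((iu2.const_mul N).add (iu.const_mul _))
          (iF.sub iD) fun p => ?_
        simp only [hA1, hB2]
        nlinarith [sq_nonneg (p.1 * pd1 u p - pd2 (pd2 u) p - p.2 * pd2 u p + N * u p - N * u p),
          mul_nonneg (zero_le_one.trans hN) (sq_nonneg (pd2 u p))]
    _ = _ := by
        rw [integral_sub iF iD, integral_const_mul, integral_sub iA iB,
          hAi, hBi]
        simp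
end
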